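/- Nonvanishing of the covariance kernel at algebraic times: let k and l be positive integers and let T be a nonzero real number that is algebraic over ℚ. Then I_{kl} = (1/(kl)) ∫₀ᵀ sin(k s) sin(l s) ds ≠ 0. In particular, for k > l this is equivalent to (k+l) sin((k−l)T) ≠ (k−l) sin((k+l)T). -/

import Mathlib

theorem lw_int_poly {K : Type*} [Field K] [CharZero K] [FiniteDimensional ℚ K]
    (φ : K →ₐ[ℚ] ℂ) (S : Finset K) (h0 : (0:K) ∉ S) :
    ∃ f : Polynomial ℤ, f.eval 0 ≠ 0 ∧ ∀ β ∈ S, φ β ∈ f.aroots ℂ := by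
  have key : ∀ β : K, ∃ q : Polynomial ℤ, β ≠ 0 → (q.coeff 0 ≠ 0 ∧ Polynomial.aeval (φ β) q = 0) := by
    intro β
    by_cases hβ : β = 0
    · exact ⟨0, fun h => absurd hβ h⟩
    · have h1 : IsAlgebraic ℚ (φ β) := IsAlgebraic.algHom φ (Algebra.IsAlgebraic.isAlgebraic (R := ℚ) β)
      have h2 : IsAlgebraic ℤ (φ β) := (IsFractionRing.isAlgebraic_iff ℤ ℚ ℂ).2 h1
      have h3 : φ β ≠ 0 := by simpa using hβ
      obtain ⟨q, hq, hq'⟩ := h2.exists_nonzero_coeff_and_aeval_eq_zero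
        (mem_nonZeroDivisors_of_ne_zero h3)
      exact ⟨q, fun _ => ⟨hq, hq'⟩⟩
  choose q hq using key
  have hS : ∀ β ∈ S, β ≠ 0 := fun β hβ h => h0 (h ▸ hβ)
  have hf0 : (∏ β ∈ S, q β).eval 0 ≠ 0 := by
    rw [Polynomial.eval_prod, Finset.prod_ne_zero_iff]
    intro β hβ
    rw [← Polynomial.coeff_zero_eq_eval_zero]
    exact (hq β (hS β hβ)).1
  refine ⟨∏ β ∈ S, q β, hf0, ?_⟩
  intro β hβ
  rw [Polynomial.mem_aroots]
  refine ⟨fun h => hf0 (by simp [h]), ?_⟩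
  rw [map_prod]
  exact Finset.prod_eq_zero hβ (hq β (hS β hβ)).2

theorem lw_integral_aeval {K : Type*} [Field K] (a : ℤ) (β : K) (h : IsIntegral ℤ (a • β))
    (g : Polynomial ℤ) (N : ℕ) (hN : g.natDegree ≤ N) :
    IsIntegral ℤ (a ^ N • Polynomial.aeval β g) := by
  rw [Polynomial.aeval_eq_sum_range' (n := N + 1) (by omega), Finset.smul_sum]
  refine IsIntegral.sum _ fun i hi => ?_
  have hi' : i ≤ N := by simpa [Nat.lt_succ_iff] using hi
  have : a ^ N • g.coeff i • β ^ i = (a ^ (N - i) * g.coeff i) • (a • β) ^ i := by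
    rw [smul_pow, smul_smul, smul_smul]
    congr 1
    have : a ^ N = a ^ (N - i) * a ^ i := by rw [← pow_add]; congr 1; omega
    rw [this]; ring
  rw [this]
  exact (h.pow i).smul _

theorem lw_small (M E : ℝ) (B : ℕ) :
    ∃ p : ℕ, p.Prime ∧ B < p ∧ |M| * (|E| ^ p / ((p - 1).factorial : ℝ)) < 1 := by
  have h := ((FloorSemiring.tendsto_pow_div_factorial_atTop |E|).const_mul (|M| * |E|))
  rw [mul_zero] at h
  obtain ⟨N, hN⟩ := Filter.eventually_atTop.1 (h.eventually (gt_mem_nhds (zero_lt_one (α := ℝ))))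
  obtain ⟨p, hp, hpp⟩ := Nat.exists_infinite_primes (N + B + 2)
  refine ⟨p, hpp, by omega, ?_⟩
  have := hN (p - 1) (by omega)
  obtain ⟨m, rfl⟩ : ∃ m, p = m + 1 := ⟨p - 1, by omega⟩
  simp only [Nat.add_sub_cancel] at this ⊢
  refine lt_of_eq_of_lt ?_ this
  rw [pow_succ]; ring

theorem lw_core {K : Type*} [Field K] [CharZero K] [FiniteDimensional ℚ K] [IsGalois ℚ K]
    (φ : K →ₐ[ℚ] ℂ) (S : Finset K) (h0 : (0:K) ∉ S) (c : K → ℤ)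
    (hS : ∀ σ : K ≃ₐ[ℚ] K, ∀ β ∈ S, σ β ∈ S)
    (hc : ∀ σ : K ≃ₐ[ℚ] K, ∀ β, c (σ β) = c β)
    (N : ℤ) (hN : N ≠ 0) :
    (N : ℂ) + ∑ β ∈ S, (c β : ℂ) * Complex.exp (φ β) ≠ 0 := by
  classical
  intro hzero
  obtain ⟨f, hf0, hf⟩ := lw_int_poly φ S h0
  have : Algebra.IsAlgebraic ℤ K := by
    have := IsLocalization.isAlgebraic ℚ (nonZeroDivisors ℤ)
    exact Algebra.IsAlgebraic.trans ℤ ℚ K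
  obtain ⟨a, ha0, ha⟩ := Algebra.IsAlgebraic.exists_integral_multiples ℤ S
  obtain ⟨C, hC⟩ := LindemannWeierstrass.exp_polynomial_approx f hf0
  set D := f.natDegree
  obtain ⟨p, hp, hpB, hsmall⟩ := lw_small (∑ β ∈ S, |(c β : ℝ)|) (|(a : ℝ)| ^ D * C)
    ((f.eval 0).natAbs + a.natAbs + N.natAbs)
  obtain ⟨n, hn, g, hg, happ⟩ := hC p (by omega) hp
  -- the algebraic sum is an integer
  have hint : ∃ m : ℤ, (a ^ (p * D)) • ∑ β ∈ S, c β • Polynomial.aeval β g = (m : K) := by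
    have hI : IsIntegral ℤ ((a ^ (p * D)) • ∑ β ∈ S, c β • Polynomial.aeval β g) := by
      rw [Finset.smul_sum]
      refine IsIntegral.sum _ fun β hβ => ?_
      rw [smul_comm]
      exact (lw_integral_aeval a β (ha β hβ) g _ (hg.trans (Nat.sub_le _ _))).smul _
    have hfix : ∀ σ : K ≃ₐ[ℚ] K, σ ((a ^ (p * D)) • ∑ β ∈ S, c β • Polynomial.aeval β g) =
        (a ^ (p * D)) • ∑ β ∈ S, c β • Polynomial.aeval β g := by
      intro σ
      rw [map_zsmul, map_sum]
      congr 1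
      have hinj : Set.InjOn σ (S : Set K) := σ.injective.injOn
      have himg : S.image σ = S :=
        Finset.eq_of_subset_of_card_le (by
          intro x hx
          obtain ⟨y, hy, rfl⟩ := Finset.mem_image.1 hx
          exact hS σ y hy) (by rw [Finset.card_image_of_injOn hinj])
      conv_rhs => rw [← himg]
      rw [Finset.sum_image hinj]
      refine Finset.sum_congr rfl fun β _ => ?_
      rw [map_zsmul, hc]
      congr 1
      exact (Polynomial.aeval_algHom_apply ((σ : K →ₐ[ℚ] K).restrictScalars ℤ) β g).symm
    obtain ⟨r, hr⟩ := IntermediateField.mem_bot.1 ((IsGalois.mem_bot_iff_fixed _).2 hfix)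
    rw [← hr] at hI
    have hI' : IsIntegral ℤ r :=
      (isIntegral_algHom_iff ((Algebra.ofId ℚ K).restrictScalars ℤ)
        (algebraMap ℚ K).injective).1 hI
    obtain ⟨m, hm⟩ := IsIntegrallyClosed.isIntegral_iff.1 hI'
    refine ⟨m, ?_⟩
    rw [← hr, ← hm]; simp
  obtain ⟨m, hm⟩ := hint
  have hm' : (a : ℂ) ^ (p * D) * ∑ β ∈ S, (c β : ℂ) * Polynomial.aeval (φ β) g = (m : ℂ) := by
    have := congrArg φ hm
    rw [map_zsmul, map_sum, map_intCast] at this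
    rw [← this, zsmul_eq_mul]
    push_cast
    congr 1
    refine Finset.sum_congr rfl fun β _ => ?_
    rw [map_zsmul, zsmul_eq_mul]
    congr 1
    exact (Polynomial.aeval_algHom_apply (φ.restrictScalars ℤ) β g)
  set Z : ℤ := a ^ (p * D) * n * N + p * m with hZ
  have hpZ : ¬ (p : ℤ) ∣ Z := by
    intro hd
    have h1 : (p : ℤ) ∣ a ^ (p * D) * n * N := (Int.dvd_add_left (dvd_mul_right _ _)).1 hd
    have hpi : Prime (p : ℤ) := Nat.prime_iff_prime_int.1 hp
    rcases hpi.dvd_or_dvd h1 with h2 | h2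
    · rcases hpi.dvd_or_dvd h2 with h3 | h3
      · have h4 := Int.natAbs_dvd_natAbs.2 (hpi.dvd_of_dvd_pow h3)
        have := Nat.le_of_dvd (Int.natAbs_pos.2 ha0) h4
        simp at this; omega
      · exact hn h3
    · have := Nat.le_of_dvd (Int.natAbs_pos.2 hN) (Int.natAbs_dvd_natAbs.2 h2)
      simp at this; omega
  have hZ1 : (1 : ℝ) ≤ ‖(Z : ℂ)‖ := by
    have : Z ≠ 0 := fun h => hpZ (h ▸ dvd_zero _)
    rw [Complex.norm_intCast]
    exact_mod_cast Int.one_le_abs this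
  have hZeq : (Z : ℂ) = -((a : ℂ) ^ (p * D) *
      ∑ β ∈ S, (c β : ℂ) * (n • Complex.exp (φ β) - p • Polynomial.aeval (φ β) g)) := by
    have e1 : ∑ β ∈ S, (c β : ℂ) * (n • Complex.exp (φ β) - p • Polynomial.aeval (φ β) g) =
        n * ∑ β ∈ S, (c β : ℂ) * Complex.exp (φ β) -
        p * ∑ β ∈ S, (c β : ℂ) * Polynomial.aeval (φ β) g := by
      rw [Finset.mul_sum, Finset.mul_sum, ← Finset.sum_sub_distrib]
      refine Finset.sum_congr rfl fun β _ => ?_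
      simp only [zsmul_eq_mul, nsmul_eq_mul]; ring
    rw [e1, hZ]
    push_cast
    rw [← hm']
    linear_combination (a : ℂ) ^ (p * D) * n * hzero
  have hle : ‖(Z : ℂ)‖ ≤ |(a : ℝ)| ^ (p * D) *
      ∑ β ∈ S, |(c β : ℝ)| * (C ^ p / ((p - 1).factorial : ℝ)) := by
    rw [hZeq, norm_neg, norm_mul, norm_pow, Complex.norm_intCast]
    gcongr
    refine (norm_sum_le _ _).trans (Finset.sum_le_sum fun β hβ => ?_)
    rw [norm_mul, Complex.norm_intCast]
    gcongr
    exact happ (hf β hβ)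
  have hle2 : |(a : ℝ)| ^ (p * D) *
      ∑ β ∈ S, |(c β : ℝ)| * (C ^ p / ((p - 1).factorial : ℝ)) ≤
      abs (∑ β ∈ S, |(c β : ℝ)|) * ((abs (|(a : ℝ)| ^ D * C)) ^ p / ((p - 1).factorial : ℝ)) := by
    have hnn : 0 ≤ ∑ β ∈ S, |(c β : ℝ)| := Finset.sum_nonneg fun _ _ => abs_nonneg _
    rw [← Finset.sum_mul, abs_of_nonneg hnn, abs_mul, abs_pow, abs_abs, mul_pow, ← pow_mul,
      mul_comm D p, mul_left_comm, mul_div_assoc]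
    refine mul_le_mul_of_nonneg_left (mul_le_mul_of_nonneg_left ?_ (by positivity)) hnn
    exact div_le_div_of_nonneg_right ((le_abs_self _).trans (abs_pow _ _).le) (by positivity)
  linarith

open AddMonoidAlgebra in
theorem lw_main {K : Type*} [Field K] [CharZero K] [FiniteDimensional ℚ K] [IsGalois ℚ K]
    (φ : K →ₐ[ℚ] ℂ) (x : AddMonoidAlgebra ℤ K) (hx : x ≠ 0) :
    (x.coeff.sum fun β b => (b : ℂ) * Complex.exp (φ β)) ≠ 0 := by
  classical
  intro hzero
  let E : Multiplicative K →* ℂ :=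
    { toFun := fun β => Complex.exp (φ β.toAdd)
      map_one' := by simp
      map_mul' := by intro a b; simp [Complex.exp_add] }
  let ev := AddMonoidAlgebra.lift ℤ ℂ K E
  have hev : ∀ y : AddMonoidAlgebra ℤ K,
      ev y = y.coeff.sum fun β b => (b : ℂ) * Complex.exp (φ β) := by
    intro y
    simp [ev, AddMonoidAlgebra.lift_apply, E]
  let act : (K ≃ₐ[ℚ] K) → (AddMonoidAlgebra ℤ K ≃ₐ[ℤ] AddMonoidAlgebra ℤ K) :=
    fun σ => AddMonoidAlgebra.domCongr ℤ ℤ (σ : K ≃+ K)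
  let ng : AddMonoidAlgebra ℤ K ≃ₐ[ℤ] AddMonoidAlgebra ℤ K :=
    AddMonoidAlgebra.domCongr ℤ ℤ (AddEquiv.neg K)
  have hact : ∀ σ y β, (act σ y).coeff (σ β) = y.coeff β := by
    intro σ y β
    simp [act, AddMonoidAlgebra.coeff_domCongr]
  have hng : ∀ y β, (ng y).coeff β = y.coeff (-β) := by
    intro y β
    simp [ng, AddMonoidAlgebra.coeff_domCongr]
  have hactmul : ∀ σ τ y, act σ (act τ y) = act (σ * τ) y := by
    intro σ τ y
    ext β
    simp [act, AddMonoidAlgebra.coeff_domCongr]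
    rfl
  let F : AddMonoidAlgebra ℤ K := ∏ σ : K ≃ₐ[ℚ] K, act σ x
  have hF : F ≠ 0 := by
    refine Finset.prod_ne_zero_iff.2 fun σ _ => ?_
    simpa using hx
  have hFinv : ∀ σ, act σ F = F := by
    intro σ
    simp only [F, map_prod, hactmul]
    exact Fintype.prod_equiv (Equiv.mulLeft σ) _ _ fun _ => rfl
  have hFcoeff : ∀ σ : K ≃ₐ[ℚ] K, ∀ β, F.coeff (σ β) = F.coeff β := by
    intro σ β
    conv_lhs => rw [← hFinv σ]
    exact hact σ F β
  have hngF : ∀ σ, act σ (ng F) = ng F := by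
    intro σ
    ext β
    obtain ⟨β, rfl⟩ := σ.surjective β
    rw [hact, hng, hng, ← map_neg, hFcoeff]
  let G := F * ng F
  have hGinv : ∀ σ : K ≃ₐ[ℚ] K, ∀ β, G.coeff (σ β) = G.coeff β := by
    intro σ β
    have : act σ G = G := by simp only [G, map_mul, hFinv, hngF]
    conv_lhs => rw [← this]
    exact hact σ G β
  have hevG : ev G = 0 := by
    have h1 : ev x = 0 := by rw [hev]; exact hzero
    have h2 : act 1 x = x := by
      ext β
      exact hact 1 x β
    have : ev F = 0 := by
      simp only [F, map_prod]
      exact Finset.prod_eq_zero (Finset.mem_univ 1) (by rw [h2, h1])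
    simp [G, this]
  have hG0 : G.coeff 0 ≠ 0 := by
    have e : G.coeff 0 = ∑ β ∈ F.coeff.support, F.coeff β * F.coeff β := by
      simp only [G]
      rw [AddMonoidAlgebra.coeff_mul, Finsupp.sum]
      refine Finset.sum_congr rfl fun β hβ => ?_
      rw [Finsupp.sum, Finset.sum_eq_single (-β)]
      · simp [hng]
      · intro b _ hb
        rw [if_neg]
        intro h
        exact hb (eq_neg_of_add_eq_zero_right h)
      · intro h
        simp at h
        simp [h]
    rw [e]
    have hs : F.coeff.support.Nonempty := by
      rw [Finsupp.support_nonempty_iff]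
      simpa using hF
    refine ne_of_gt (Finset.sum_pos (fun β hβ => ?_) hs)
    exact mul_self_pos.2 (Finsupp.mem_support_iff.1 hβ)
  refine lw_core φ (G.coeff.support.erase 0) (by simp) G.coeff ?_ hGinv (G.coeff 0) hG0 ?_
  · intro σ β hβ
    simp only [Finset.mem_erase, Finsupp.mem_support_iff] at hβ ⊢
    rw [hGinv]
    exact ⟨by simpa using hβ.1, hβ.2⟩
  · rw [hev, Finsupp.sum, ← Finset.add_sum_erase _ _ (Finsupp.mem_support_iff.2 hG0)] at hevG
    simpa using hevG

theorem lw_field (α : ℂ) (hαalg : IsAlgebraic ℚ α) :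
    ∃ (K : Type) (_ : Field K) (_ : CharZero K) (_ : FiniteDimensional ℚ K) (_ : IsGalois ℚ K)
      (φ : K →ₐ[ℚ] ℂ) (a : K), φ a = α := by
  let K₀ := IntermediateField.adjoin ℚ {α}
  have : FiniteDimensional ℚ K₀ := IntermediateField.adjoin.finiteDimensional hαalg.isIntegral
  let K := IntermediateField.normalClosure ℚ K₀ ℂ
  have hnc : IsNormalClosure ℚ K₀ K :=
    Algebra.IsAlgebraic.isNormalClosure_normalClosure (fun x => IsAlgClosed.splits _)
  have : Normal ℚ K := hnc.normal
  have : IsGalois ℚ K := ⟨⟩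
  have hmem : α ∈ K := K₀.le_normalClosure (IntermediateField.mem_adjoin_simple_self ℚ α)
  have hfd : FiniteDimensional ℚ K := inferInstance
  have e : (K.algebra' : Algebra ℚ K) = DivisionRing.toRatAlgebra := Subsingleton.elim _ _
  refine ⟨K, inferInstance, inferInstance, ?_, ?_, K.val.toRingHom.toRatAlgHom, ⟨α, hmem⟩, rfl⟩
  · convert hfd
  · convert this

theorem lw_sin (k l : ℕ) (hl : 0 < l) (hlk : l < k) (T : ℝ) (hT : T ≠ 0)
    (halg : IsAlgebraic ℚ T) :
    ((k:ℝ) + l) * Real.sin (((k:ℝ) - l) * T) ≠ ((k:ℝ) - l) * Real.sin (((k:ℝ) + l) * T) := by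
  classical
  intro h
  set α : ℂ := T * Complex.I with hα
  have hα0 : α ≠ 0 := by simp [hα, hT]
  have hI : IsAlgebraic ℚ Complex.I := by
    refine (IsIntegral.isAlgebraic ?_)
    exact Complex.isIntegral_rat_I
  have hTc : IsAlgebraic ℚ (T : ℂ) :=
    IsAlgebraic.algHom ((Algebra.ofId ℝ ℂ).restrictScalars ℚ) halg
  have hαalg : IsAlgebraic ℚ α := hTc.mul hI
  obtain ⟨K, _, _, _, _, φ, a, ha⟩ := lw_field α hαalg
  have ha0 : a ≠ 0 := fun h => hα0 (by rw [← ha, h, map_zero])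
  let A : ℤ := k + l
  let B : ℤ := k - l
  have hA : 0 < A := by simp only [A]; omega
  have hB : 0 < B := by simp only [B]; omega
  have hAB : B < A := by simp only [A, B]; omega
  have hinj : ∀ m n : ℤ, m • a = n • a ↔ m = n := fun m n => (smul_left_injective ℤ ha0).eq_iff
  let x : AddMonoidAlgebra ℤ K :=
    AddMonoidAlgebra.single (B • a) A + AddMonoidAlgebra.single ((-B) • a) (-A) +
    AddMonoidAlgebra.single (A • a) (-B) + AddMonoidAlgebra.single ((-A) • a) B
  have hx : x ≠ 0 := by
    intro hx
    have := congrArg (fun y => y.coeff (A • a)) hx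
    simp only [x, AddMonoidAlgebra.coeff_add, AddMonoidAlgebra.coeff_single, Finsupp.add_apply,
      Finsupp.single_apply, hinj, AddMonoidAlgebra.coeff_zero, Finsupp.zero_apply] at this
    rw [if_neg (by omega), if_neg (by omega), if_pos trivial, if_neg (by omega)] at this
    omega
  apply lw_main φ x hx
  have hz : ∀ β : K, ((0 : ℤ) : ℂ) * Complex.exp (φ β) = 0 := by simp
  have hadd : ∀ (β : K) (b c : ℤ), ((b + c : ℤ) : ℂ) * Complex.exp (φ β) =
      (b : ℂ) * Complex.exp (φ β) + (c : ℂ) * Complex.exp (φ β) := by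
    intro β b c; push_cast; ring
  simp only [x, AddMonoidAlgebra.coeff_add, AddMonoidAlgebra.coeff_single]
  rw [Finsupp.sum_add_index' hz hadd, Finsupp.sum_add_index' hz hadd,
    Finsupp.sum_add_index' hz hadd, Finsupp.sum_single_index (hz _),
    Finsupp.sum_single_index (hz _), Finsupp.sum_single_index (hz _),
    Finsupp.sum_single_index (hz _)]
  have hval : ∀ m : ℤ, φ (m • a) = ((m : ℂ) * T) * Complex.I := by
    intro m
    rw [map_zsmul, zsmul_eq_mul, mul_assoc, ha]
  simp only [hval]
  have hc : ((A : ℂ)) * Complex.sin ((B : ℂ) * T) = (B : ℂ) * Complex.sin ((A : ℂ) * T) := by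
    simp only [A, B]
    push_cast
    exact_mod_cast congrArg (fun r : ℝ => (r : ℂ)) h
  have hs : ∀ z : ℂ, Complex.exp (z * Complex.I) - Complex.exp (-z * Complex.I) =
      2 * Complex.I * Complex.sin z := by
    intro z
    rw [Complex.exp_mul_I, Complex.exp_mul_I, Complex.cos_neg, Complex.sin_neg]
    ring
  have h1 := hs ((B : ℂ) * T)
  have h2 := hs ((A : ℂ) * T)
  push_cast
  rw [neg_mul (B : ℂ) (T : ℂ), neg_mul (A : ℂ) (T : ℂ)]
  linear_combination (A : ℂ) * h1 - (B : ℂ) * h2 + 2 * Complex.I * hc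

theorem lw_integral (k l : ℝ) (T : ℝ) (h1 : k - l ≠ 0) (h2 : k + l ≠ 0) :
    ∫ s in (0:ℝ)..T, Real.sin (k * s) * Real.sin (l * s) =
      ((k + l) * Real.sin ((k - l) * T) - (k - l) * Real.sin ((k + l) * T)) /
        (2 * (k - l) * (k + l)) := by
  rw [intervalIntegral.integral_eq_sub_of_hasDerivAt (f := fun s =>
    ((k + l) * Real.sin ((k - l) * s) - (k - l) * Real.sin ((k + l) * s)) /
        (2 * (k - l) * (k + l)))]
  · simp
  · intro s _
    have e1 : HasDerivAt (fun s : ℝ => Real.sin ((k - l) * s))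
        (Real.cos ((k - l) * s) * ((k - l) * 1)) s := ((hasDerivAt_id s).const_mul (k - l)).sin
    have e2 : HasDerivAt (fun s : ℝ => Real.sin ((k + l) * s))
        (Real.cos ((k + l) * s) * ((k + l) * 1)) s := ((hasDerivAt_id s).const_mul (k + l)).sin
    refine (((e1.const_mul (k + l)).sub (e2.const_mul (k - l))).div_const _).congr_deriv ?_
    rw [sub_mul k l s, add_mul k l s, Real.cos_sub, Real.cos_add]
    field_simp
    ring
  · exact Continuous.intervalIntegrable (by fun_prop) _ _

theorem lw_integral_self (k : ℝ) (T : ℝ) (hk : k ≠ 0) :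
    ∫ s in (0:ℝ)..T, Real.sin (k * s) * Real.sin (k * s) =
      (2 * k * T - Real.sin (2 * k * T)) / (4 * k) := by
  rw [intervalIntegral.integral_eq_sub_of_hasDerivAt (f := fun s =>
    (2 * k * s - Real.sin (2 * k * s)) / (4 * k))]
  · simp
  · intro s _
    have e0 : HasDerivAt (fun s : ℝ => 2 * k * s) (2 * k * 1) s :=
      (hasDerivAt_id s).const_mul (2 * k)
    refine ((e0.sub e0.sin).div_const _).congr_deriv ?_
    rw [mul_assoc 2 k s, Real.cos_two_mul, Real.cos_sq']
    field_simp
    ring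
  · exact Continuous.intervalIntegrable (by fun_prop) _ _

/-- Nonvanishing of the covariance kernel at algebraic times: for positive integers
`k, l` and a nonzero real `T` algebraic over `ℚ`,
`I_{kl} = (1/(kl)) ∫₀ᵀ sin(ks) sin(ls) ds ≠ 0`; in particular, for `k > l` this is
equivalent to `(k+l) sin((k−l)T) ≠ (k−l) sin((k+l)T)`. -/
theorem covariance_kernel_nonvanishing (k l : ℕ) (hk : 0 < k) (hl : 0 < l)
    (T : ℝ) (hT : T ≠ 0) (halg : IsAlgebraic ℚ T) :
    ((1 / ((k:ℝ) * l)) * ∫ s in (0:ℝ)..T, Real.sin (k * s) * Real.sin (l * s)) ≠ 0 ∧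
    (l < k →
      (((1 / ((k:ℝ) * l)) * ∫ s in (0:ℝ)..T, Real.sin (k * s) * Real.sin (l * s)) ≠ 0 ↔
        ((k:ℝ) + l) * Real.sin (((k:ℝ) - l) * T) ≠
        ((k:ℝ) - l) * Real.sin (((k:ℝ) + l) * T))) := by
  have hk' : (0:ℝ) < k := by exact_mod_cast hk
  have hl' : (0:ℝ) < l := by exact_mod_cast hl
  have hmain : ∀ k l : ℕ, 0 < l → l < k →
      ∫ s in (0:ℝ)..T, Real.sin (k * s) * Real.sin (l * s) ≠ 0 := by
    intro k l hl hlk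
    have hl' : (0:ℝ) < l := by exact_mod_cast hl
    have hlk' : (l:ℝ) < k := by exact_mod_cast hlk
    have h1 : (k:ℝ) - l ≠ 0 := by linarith
    have h2 : (k:ℝ) + l ≠ 0 := by linarith
    rw [lw_integral _ _ T h1 h2]
    refine div_ne_zero (sub_ne_zero.2 (lw_sin k l hl hlk T hT halg)) ?_
    exact mul_ne_zero (mul_ne_zero two_ne_zero h1) h2
  have hfirst : ((1 / ((k:ℝ) * l)) *
      ∫ s in (0:ℝ)..T, Real.sin (k * s) * Real.sin (l * s)) ≠ 0 := by
    refine mul_ne_zero (by positivity) ?_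
    rcases lt_trichotomy k l with h | h | h
    · have := hmain l k hk h
      simpa only [mul_comm] using this
    · subst h
      rw [lw_integral_self _ T hk'.ne']
      refine div_ne_zero (sub_ne_zero.2 ?_) (by positivity)
      intro he
      have hne : 2 * (k:ℝ) * T ≠ 0 := by positivity
      rcases lt_or_gt_of_ne hne with h | h
      · have := Real.lt_sin h
        linarith
      · have := Real.sin_lt h
        linarith
    · exact hmain k l hl h
  exact ⟨hfirst, fun hlk => ⟨fun _ => lw_sin k l hl hlk T hT halg, fun _ => hfirst⟩⟩
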